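/- Let G be a group acting specially on a quasi-median graph X, and suppose there exists D ∈ ℕ such that every vertex of the quotient graph ΔX/G has at most D neighbours. If the crossing graph ΔX is connected and ΔX/G has finitely many vertices, then the inclusion map ΔX ↪ CX is a quasi-isometry. -/

import Mathlib

namespace QM

variable {V : Type*}

/-- `y₁` and `y₂` lie (in this order) on a common geodesic from `x₁` to `x₂`. -/
def OnGeod (X : SimpleGraph V) (x₁ y₁ y₂ x₂ : V) : Prop :=
  X.dist x₁ y₁ + X.dist y₁ y₂ + X.dist y₂ x₂ = X.dist x₁ x₂

/-- `(y₁, y₂, y₃)` is a `k`-quasi-median triple for `(x₁, x₂, x₃)` (without minimality). -/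
def IsQMTriple (X : SimpleGraph V) (x₁ x₂ x₃ y₁ y₂ y₃ : V) (k : ℕ) : Prop :=
  OnGeod X x₁ y₁ y₂ x₂ ∧ OnGeod X x₁ y₁ y₃ x₃ ∧ OnGeod X x₂ y₂ y₃ x₃ ∧
    X.dist y₁ y₂ = k ∧ X.dist y₁ y₃ = k ∧ X.dist y₂ y₃ = k

/-- `y` is a quasi-median of the triple `(x₁, x₂, x₃)`: it is a `k`-quasi-median triple
with `k` as small as possible. -/
def IsQuasiMedianTriple (X : SimpleGraph V) (x₁ x₂ x₃ : V) (y : V × V × V) : Prop :=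
  ∃ k : ℕ, IsQMTriple X x₁ x₂ x₃ y.1 y.2.1 y.2.2 k ∧
    ∀ (k' : ℕ) (z₁ z₂ z₃ : V), IsQMTriple X x₁ x₂ x₃ z₁ z₂ z₃ k' → k ≤ k'

/-- The complete multipartite graph `K_{1,1,2}`: the complete graph on four vertices
with the edge between vertices `2` and `3` removed. -/
def K112 : SimpleGraph (Fin 4) :=
  SimpleGraph.fromRel (fun i j => ¬(i = 2 ∧ j = 3) ∧ ¬(i = 3 ∧ j = 2))

/-- The 1-skeleton of the 3-cube. -/
def cubeGraph : SimpleGraph (Fin 3 → Bool) :=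
  SimpleGraph.fromRel (fun x y => ∃! i, x i ≠ y i)

/-- The 6-cycle. -/
def C6 : SimpleGraph (Fin 6) := SimpleGraph.fromRel (fun i j => j = i + 1)

/-- A set of vertices is convex if it contains every vertex lying on a geodesic between
two of its members. -/
def IsConvexSet (X : SimpleGraph V) (S : Set V) : Prop :=
  ∀ x ∈ S, ∀ y ∈ S, ∀ z : V, X.dist x z + X.dist z y = X.dist x y → z ∈ S

/-- The convex hull of a set of vertices. -/
def convexHullSet (X : SimpleGraph V) (S : Set V) : Set V :=
  ⋂₀ {T : Set V | S ⊆ T ∧ IsConvexSet X T}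

/-- A quasi-median graph: a connected graph in which every triple of vertices has a unique
quasi-median, with no induced `K_{1,1,2}`, and in which the convex hull of every isometrically
embedded 6-cycle is isomorphic to the 3-cube. -/
structure IsQuasiMedian (X : SimpleGraph V) : Prop where
  connected : X.Connected
  uniqueQuasiMedian : ∀ x₁ x₂ x₃ : V, ∃! y : V × V × V, IsQuasiMedianTriple X x₁ x₂ x₃ y
  noK112 : IsEmpty (SimpleGraph.Embedding K112 X)
  hullOfC6IsCube : ∀ f : Fin 6 → V,
    (∀ i j, C6.Adj i j → X.Adj (f i) (f j)) →
    (∀ i j, X.dist (f i) (f j) = C6.dist i j) →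
    Nonempty (SimpleGraph.Iso
      (SimpleGraph.induce (convexHullSet X (Set.range f)) X) cubeGraph)

/-- Two edges are two sides of a common triangle, or opposite sides of a common square. -/
def SideRel (X : SimpleGraph V) (e f : Sym2 V) : Prop :=
  (∃ a b c : V, X.Adj a b ∧ X.Adj a c ∧ X.Adj b c ∧ e = s(a, b) ∧ f = s(a, c)) ∨
  (∃ a b c d : V, X.Adj a b ∧ X.Adj c d ∧ X.Adj a c ∧ X.Adj b d ∧ a ≠ d ∧ b ≠ c ∧
    e = s(a, b) ∧ f = s(c, d))

/-- The equivalence class of an edge under the equivalence relation generated by `SideRel`. -/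
def hypClass (X : SimpleGraph V) (e : Sym2 V) : Set (Sym2 V) :=
  {f | Relation.EqvGen (SideRel X) e f}

/-- A hyperplane: the equivalence class of some edge of `X`. -/
def IsHyperplane (X : SimpleGraph V) (H : Set (Sym2 V)) : Prop :=
  ∃ e ∈ X.edgeSet, H = hypClass X e

/-- The type of hyperplanes of `X`. -/
def Hyperplane (X : SimpleGraph V) := {H : Set (Sym2 V) // IsHyperplane X H}

/-- Edges `e`, `e'` sharing the endpoint `p`, not lying in a common clique, that are
adjacent sides of a square of `X`: their dual hyperplanes intersect at `p`. -/
def IntersectAt (X : SimpleGraph V) (e e' : Sym2 V) (p : V) : Prop :=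
  ∃ a b : V, e = s(p, a) ∧ e' = s(p, b) ∧ X.Adj p a ∧ X.Adj p b ∧ a ≠ b ∧ ¬ X.Adj a b ∧
    ∃ q : V, q ≠ p ∧ X.Adj a q ∧ X.Adj b q

/-- Edges `e`, `e'` sharing the endpoint `p`, not lying in a common clique, and not adjacent
sides of any square of `X`: their dual hyperplanes osculate at `p`. -/
def OsculateAt (X : SimpleGraph V) (e e' : Sym2 V) (p : V) : Prop :=
  ∃ a b : V, e = s(p, a) ∧ e' = s(p, b) ∧ X.Adj p a ∧ X.Adj p b ∧ a ≠ b ∧ ¬ X.Adj a b ∧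
    ¬ ∃ q : V, q ≠ p ∧ X.Adj a q ∧ X.Adj b q

/-- Hyperplanes `H` and `H'` intersect at `p`. -/
def HypIntersectAt (X : SimpleGraph V) (H H' : Hyperplane X) (p : V) : Prop :=
  ∃ e ∈ H.1, ∃ e' ∈ H'.1, IntersectAt X e e' p

/-- Hyperplanes `H` and `H'` osculate at `p`. -/
def HypOsculateAt (X : SimpleGraph V) (H H' : Hyperplane X) (p : V) : Prop :=
  ∃ e ∈ H.1, ∃ e' ∈ H'.1, OsculateAt X e e' p

/-- Hyperplanes `H` and `H'` intersect. -/
def HypIntersect (X : SimpleGraph V) (H H' : Hyperplane X) : Prop :=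
  ∃ p : V, HypIntersectAt X H H' p

/-- Hyperplanes `H` and `H'` osculate. -/
def HypOsculate (X : SimpleGraph V) (H H' : Hyperplane X) : Prop :=
  ∃ p : V, HypOsculateAt X H H' p

/-- The contact graph `𝒞X`: hyperplanes are adjacent iff they intersect or osculate. -/
def contactGraph (X : SimpleGraph V) : SimpleGraph (Hyperplane X) :=
  SimpleGraph.fromRel (fun H H' => HypIntersect X H H' ∨ HypOsculate X H H')

/-- The crossing graph `ΔX`: hyperplanes are adjacent iff they intersect. -/
def crossingGraph (X : SimpleGraph V) : SimpleGraph (Hyperplane X) :=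
  SimpleGraph.fromRel (fun H H' => HypIntersect X H H')

/-- The (vertex set of the) carrier of a hyperplane: all endpoints of its edges. -/
def hypCarrier (X : SimpleGraph V) (H : Hyperplane X) : Set V :=
  {v : V | ∃ e ∈ H.1, v ∈ e}

/-- A set of edges `H` (e.g. a hyperplane) separates `p` from `q` if every walk from `p`
to `q` uses an edge of `H`. -/
def Separates (X : SimpleGraph V) (H : Set (Sym2 V)) (p q : V) : Prop :=
  ∀ w : X.Walk p q, ∃ e ∈ w.edges, e ∈ H

/-- `f` is a `(λ, c)`-quasi-isometry from `(A, dA)` to `(B, dB)`. -/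
def IsQuasiIsometry {A B : Type*} (lam c : ℝ) (dA : A → A → ℝ) (dB : B → B → ℝ)
    (f : A → B) : Prop :=
  (∀ x y : A, dA x y / lam - c ≤ dB (f x) (f y) ∧ dB (f x) (f y) ≤ lam * dA x y + c) ∧
    ∀ b : B, ∃ a : A, dB (f a) b ≤ c

end QM

namespace QM

variable {V : Type*} {G : Type*} [Group G]

/-- An action of a group `G` on a graph `X` by graph automorphisms. -/
structure GraphAction (G : Type*) [Group G] {V : Type*} (X : SimpleGraph V) where
  act : G → V → V
  act_one : ∀ v, act 1 v = v
  act_mul : ∀ g h v, act (g * h) v = act g (act h v)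
  act_adj : ∀ g a b, X.Adj (act g a) (act g b) ↔ X.Adj a b

/-- The image of a set of edges under the action of `g`. -/
def GraphAction.hypImage {X : SimpleGraph V} (α : GraphAction G X) (g : G)
    (H : Set (Sym2 V)) : Set (Sym2 V) :=
  Sym2.map (α.act g) '' H

/-- Two hyperplanes are in the same orbit of the induced action of `G` on hyperplanes. -/
def SameOrbit {X : SimpleGraph V} (α : GraphAction G X) (H H' : Hyperplane X) : Prop :=
  ∃ g : G, H'.1 = α.hypImage g H.1

/-- The set of `G`-orbits of hyperplanes. -/
def HypOrbit {X : SimpleGraph V} (α : GraphAction G X) := Quot (SameOrbit α)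

/-- The quotient graph `ΔX/G`: vertices are `G`-orbits of hyperplanes, two orbits being
adjacent iff some representatives are adjacent in the crossing graph `ΔX`. -/
def quotCrossingGraph {X : SimpleGraph V} (α : GraphAction G X) :
    SimpleGraph (HypOrbit α) :=
  SimpleGraph.fromRel (fun O O' => ∃ H H' : Hyperplane X,
    Quot.mk (SameOrbit α) H = O ∧ Quot.mk (SameOrbit α) H' = O' ∧ (crossingGraph X).Adj H H')

/-- Every vertex of the quotient graph `ΔX/G` has at most `D` neighbours. -/
def QuotDegBounded {X : SimpleGraph V} (α : GraphAction G X) (D : ℕ) : Prop :=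
  ∀ O : HypOrbit α, ((quotCrossingGraph α).neighborSet O).Finite ∧
    ((quotCrossingGraph α).neighborSet O).ncard ≤ D

/-- The action is special: (i) no two distinct hyperplanes in the same `G`-orbit intersect
or osculate; (ii) if two hyperplanes intersect, then no `G`-translate of the first osculates
with the second. -/
def IsSpecial {X : SimpleGraph V} (α : GraphAction G X) : Prop :=
  (∀ H H' : Hyperplane X, SameOrbit α H H' → H ≠ H' →
      ¬(HypIntersect X H H' ∨ HypOsculate X H H')) ∧
  (∀ H H' K : Hyperplane X, HypIntersect X H H' → SameOrbit α H K →
      ¬ HypOsculate X K H')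

/-- The `g`-translate of the hyperplane `A` is within contact-graph distance `ε` of `A`. -/
def TranslateDistLE {X : SimpleGraph V} (α : GraphAction G X) (g : G)
    (A : Hyperplane X) (ε : ℝ) : Prop :=
  ∃ A' : Hyperplane X, A'.1 = α.hypImage g A.1 ∧ ((contactGraph X).dist A A' : ℝ) ≤ ε

end QM


namespace QM

variable {V : Type*} {X : SimpleGraph V}

section WeakModularity

/-- Distances to adjacent vertices differ by at most one. -/
lemma IsQuasiMedian.dist_le_succ (hX : IsQuasiMedian X) (u : V) {a b : V} (h : X.Adj a b) :
    X.dist u a ≤ X.dist u b + 1 := by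
  have h1 := hX.connected.dist_triangle (u := u) (v := b) (w := a)
  have h2 := SimpleGraph.dist_eq_one_iff_adj.mpr h.symm
  omega

lemma IsQuasiMedian.dist_eq_two (hX : IsQuasiMedian X) {a b c : V} (hne : a ≠ b)
    (hab : ¬ X.Adj a b) (hac : X.Adj a c) (hcb : X.Adj c b) : X.dist a b = 2 := by
  have h1 := hX.dist_le_succ a hcb.symm
  have h2 := SimpleGraph.dist_eq_one_iff_adj.mpr hac
  have h3 : X.dist a b ≠ 0 := fun h => hne (hX.connected.dist_eq_zero_iff.mp h)
  have h4 : X.dist a b ≠ 1 := fun h => hab (SimpleGraph.dist_eq_one_iff_adj.mp h)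
  omega

lemma IsQuasiMedian.exists_closer (hX : IsQuasiMedian X) {u v : V} (hne : u ≠ v) :
    ∃ w, X.Adj w v ∧ X.dist u w + 1 = X.dist u v := by
  obtain ⟨p, hp⟩ := hX.connected.exists_walk_length_eq_dist v u
  cases p with
  | nil => exact absurd rfl hne
  | @cons _ w _ h q =>
    rw [SimpleGraph.Walk.length_cons, X.dist_comm] at hp
    have h1 := SimpleGraph.dist_le q
    rw [X.dist_comm] at h1
    have h2 := hX.dist_le_succ u h
    exact ⟨w, h.symm, by omega⟩

/-- The triangle condition. -/
lemma IsQuasiMedian.triangle_condition (hX : IsQuasiMedian X) {u v w : V} (hvw : X.Adj v w)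
    (h : X.dist u v = X.dist u w) :
    ∃ x, X.Adj x v ∧ X.Adj x w ∧ X.dist u x + 1 = X.dist u v := by
  obtain ⟨⟨y₁, y₂, y₃⟩, ⟨k, ⟨g₁, g₂, g₃, e₁, e₂, e₃⟩, -⟩, -⟩ := hX.uniqueQuasiMedian u v w
  simp only [OnGeod] at g₁ g₂ g₃ e₁ e₂ e₃
  have h1 := SimpleGraph.dist_eq_one_iff_adj.mpr hvw
  have c1 := X.dist_comm (u := v) (v := y₂)
  have hk : k = 1 := by omega
  have hv : X.dist v y₂ = 0 := by omega
  have hw : X.dist y₃ w = 0 := by omega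
  obtain rfl := hX.connected.dist_eq_zero_iff.mp hv
  obtain rfl := hX.connected.dist_eq_zero_iff.mp hw
  subst hk
  exact ⟨y₁, SimpleGraph.dist_eq_one_iff_adj.mp e₁, SimpleGraph.dist_eq_one_iff_adj.mp e₂,
    by omega⟩

/-- Two distinct common neighbours of adjacent vertices are adjacent. -/
lemma IsQuasiMedian.adj_of_common (hX : IsQuasiMedian X) {a b c e : V} (hab : X.Adj a b)
    (hca : X.Adj c a) (hcb : X.Adj c b) (hea : X.Adj e a) (heb : X.Adj e b) (hce : c ≠ e) :
    X.Adj c e := by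
  by_contra hn
  have hn' : ¬ X.Adj e c := fun h => hn h.symm
  let f : Fin 4 → V := ![a, b, c, e]
  have hf : Function.Injective f := by
    intro i j hij
    fin_cases i <;> fin_cases j <;> first
      | rfl
      | (exfalso
         simp [f] at hij
         first
          | exact hab.ne hij | exact hab.ne hij.symm | exact hca.ne hij | exact hca.ne hij.symm
          | exact hcb.ne hij | exact hcb.ne hij.symm | exact hea.ne hij | exact hea.ne hij.symm
          | exact heb.ne hij | exact heb.ne hij.symm | exact hce hij | exact hce hij.symm)
  refine hX.noK112.false ⟨⟨f, hf⟩, ?_⟩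
  intro i j
  fin_cases i <;> fin_cases j <;>
    simp [f, K112, SimpleGraph.fromRel_adj, hab, hca, hcb, hea, heb, hab.symm, hca.symm,
      hcb.symm, hea.symm, heb.symm, hn, hn']

/-- Vertices at distance two have at most two common neighbours. -/
lemma IsQuasiMedian.common_nbrs (hX : IsQuasiMedian X) {a d b₁ b₂ b₃ : V} (hne : a ≠ d)
    (had : ¬ X.Adj a d) (ha₁ : X.Adj a b₁) (ha₂ : X.Adj a b₂) (ha₃ : X.Adj a b₃)
    (hd₁ : X.Adj d b₁) (hd₂ : X.Adj d b₂) (hd₃ : X.Adj d b₃) :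
    b₁ = b₂ ∨ b₁ = b₃ ∨ b₂ = b₃ := by
  by_contra! hcon
  obtain ⟨n12, n13, n23⟩ := hcon
  have e12 := hX.dist_eq_two n12 (fun h => had (hX.adj_of_common h ha₁ ha₂ hd₁ hd₂ hne))
    ha₁.symm ha₂
  have e13 := hX.dist_eq_two n13 (fun h => had (hX.adj_of_common h ha₁ ha₃ hd₁ hd₃ hne))
    ha₁.symm ha₃
  have e23 := hX.dist_eq_two n23 (fun h => had (hX.adj_of_common h ha₂ ha₃ hd₂ hd₃ hne))
    ha₂.symm ha₃
  have key : ∀ x, X.Adj x b₁ → X.Adj x b₂ → X.Adj x b₃ →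
      IsQuasiMedianTriple X b₁ b₂ b₃ (x, x, x) := by
    intro x h1 h2 h3
    have h1' := SimpleGraph.dist_eq_one_iff_adj.mpr h1.symm
    have h2' := SimpleGraph.dist_eq_one_iff_adj.mpr h2
    have h2'' := SimpleGraph.dist_eq_one_iff_adj.mpr h2.symm
    have h3' := SimpleGraph.dist_eq_one_iff_adj.mpr h3
    refine ⟨0, ⟨?_, ?_, ?_, ?_, ?_, ?_⟩, fun _ _ _ _ _ => Nat.zero_le _⟩ <;>
      simp [OnGeod, *]
  have := (hX.uniqueQuasiMedian b₁ b₂ b₃).unique (key a ha₁ ha₂ ha₃) (key d hd₁ hd₂ hd₃)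
  exact hne (congrArg Prod.fst this)

lemma cubeGraph_common_nbr (a b c p r : Fin 3 → Bool) (hab : a ≠ b) (hac : a ≠ c) (hbc : b ≠ c)
    (hap : cubeGraph.Adj a p) (hbp : cubeGraph.Adj b p)
    (har : cubeGraph.Adj a r) (hcr : cubeGraph.Adj c r) :
    ∃ e, cubeGraph.Adj e a ∧ cubeGraph.Adj e b ∧ cubeGraph.Adj e c := by
  have hadj : ∀ x y : Fin 3 → Bool, cubeGraph.Adj x y ↔
      ∃ i, x i ≠ y i ∧ ∀ j, x j ≠ y j → j = i := by
    intro x y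
    simp only [cubeGraph, SimpleGraph.fromRel_adj]
    constructor
    · rintro ⟨-, h | ⟨i, hi, h⟩⟩
      · exact h
      · exact ⟨i, hi.symm, fun j hj => h j hj.symm⟩
    · rintro ⟨i, hi, h⟩
      exact ⟨fun hxy => hi (congrFun hxy i), Or.inl ⟨i, hi, h⟩⟩
  have hpar : ∀ x y : Fin 3 → Bool, (∃ i, x i ≠ y i ∧ ∀ j, x j ≠ y j → j = i) →
      (x 0 ^^ x 1 ^^ x 2) = !(y 0 ^^ y 1 ^^ y 2) := by decide
  have hfin : ∀ x y z : Fin 3 → Bool, x ≠ y → x ≠ z → y ≠ z →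
      (x 0 ^^ x 1 ^^ x 2) = (y 0 ^^ y 1 ^^ y 2) → (x 0 ^^ x 1 ^^ x 2) = (z 0 ^^ z 1 ^^ z 2) →
      ∃ e : Fin 3 → Bool, (∃ i, e i ≠ x i ∧ ∀ j, e j ≠ x j → j = i) ∧ (∃ i, e i ≠ y i ∧ ∀ j, e j ≠ y j → j = i) ∧
         (∃ i, e i ≠ z i ∧ ∀ j, e j ≠ z j → j = i) := by
    decide +kernel
  simp only [hadj] at *
  exact hfin a b c hab hac hbc ((hpar _ _ hap).trans (hpar _ _ hbp).symm)
    ((hpar _ _ har).trans (hpar _ _ hcr).symm)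

/-- The vertices of an isometric 6-cycle at even positions have a common neighbour. -/
lemma IsQuasiMedian.hexagon (hX : IsQuasiMedian X) {a b c d e f : V} (hab : X.Adj a b)
    (hbc : X.Adj b c) (hcd : X.Adj c d) (hde : X.Adj d e) (hef : X.Adj e f) (hfa : X.Adj f a)
    (had : X.dist a d = 3) (hbe : X.dist b e = 3) (hcf : X.dist c f = 3) :
    ∃ x, X.Adj x a ∧ X.Adj x c ∧ X.Adj x e := by
  let F : Fin 6 → V := ![a, b, c, d, e, f]
  have hF : ∀ i j, C6.Adj i j → X.Adj (F i) (F j) := by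
    intro i j hij
    rw [C6, SimpleGraph.fromRel_adj] at hij
    have hs : ∀ i : Fin 6, X.Adj (F i) (F (i + 1)) := by
      intro i
      fin_cases i
      exacts [hab, hbc, hcd, hde, hef, hfa]
    rcases hij.2 with rfl | rfl
    · exact hs _
    · exact (hs _).symm
  have hC1 : ∀ i : Fin 6, C6.Adj i (i + 1) := by
    intro i
    rw [C6, SimpleGraph.fromRel_adj]
    exact ⟨by revert i; decide, Or.inl rfl⟩
  have hC2 : ∀ i : Fin 6, C6.dist i (i + 1 + 1) ≤ 2 := fun i =>
    SimpleGraph.dist_le (.cons (hC1 i) (.cons (hC1 (i + 1)) .nil))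
  have hC3 : ∀ i : Fin 6, C6.dist i (i + 1 + 1 + 1) ≤ 3 := fun i =>
    SimpleGraph.dist_le (.cons (hC1 i) (.cons (hC1 (i + 1)) (.cons (hC1 (i + 1 + 1)) .nil)))
  have hpre : ∀ i j : Fin 6, C6.Reachable i j := by
    have h0 : ∀ i : Fin 6, C6.Reachable i 0 := by
      have s := fun i => (hC1 i).reachable
      intro i
      fin_cases i
      exacts [.refl _, (s 0).symm, ((s 0).trans (s 1)).symm, (s 3).trans ((s 4).trans (s 5)),
        (s 4).trans (s 5), s 5]
    exact fun i j => (h0 i).trans (h0 j).symm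
  have hle : ∀ i j, X.dist (F i) (F j) ≤ C6.dist i j := by
    intro i j
    obtain ⟨p, hp⟩ := (hpre i j).exists_walk_length_eq_dist
    have := SimpleGraph.dist_le (p.map ⟨F, fun {a b} h => hF a b h⟩)
    rw [SimpleGraph.Walk.length_map, hp] at this
    exact this
  have h3 : ∀ i : Fin 6, X.dist (F i) (F (i + 1 + 1 + 1)) = 3 := by
    intro i
    fin_cases i
    exacts [had, hbe, hcf, X.dist_comm.trans had, X.dist_comm.trans hbe, X.dist_comm.trans hcf]
  have h2 : ∀ i : Fin 6, 2 ≤ X.dist (F i) (F (i + 1 + 1)) := by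
    intro i
    have := hX.dist_le_succ (F i) (hF _ _ (hC1 (i + 1 + 1))).symm
    have := h3 i
    omega
  have h1 : ∀ i : Fin 6, X.dist (F i) (F (i + 1)) = 1 := fun i =>
    SimpleGraph.dist_eq_one_iff_adj.mpr (hF _ _ (hC1 i))
  have hcases : ∀ i j : Fin 6, i = j ∨ j = i + 1 ∨ j = i + 1 + 1 ∨ j = i + 1 + 1 + 1 ∨
      i = j + 1 ∨ i = j + 1 + 1 := by decide
  have hge : ∀ i j, C6.dist i j ≤ X.dist (F i) (F j) := by
    intro i j
    rcases hcases i j with rfl | rfl | rfl | rfl | rfl | rfl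
    · simp
    · rw [h1, SimpleGraph.dist_eq_one_iff_adj.mpr (hC1 i)]
    · exact (hC2 i).trans (h2 i)
    · rw [h3]; exact hC3 i
    · rw [C6.dist_comm, X.dist_comm, h1, SimpleGraph.dist_eq_one_iff_adj.mpr (hC1 j)]
    · rw [C6.dist_comm, X.dist_comm]; exact (hC2 j).trans (h2 j)
  obtain ⟨φ⟩ := hX.hullOfC6IsCube F hF (fun i j => le_antisymm (hle i j) (hge i j))
  have hmem : ∀ i, F i ∈ convexHullSet X (Set.range F) := fun i =>
    Set.mem_sInter.mpr fun T hT => hT.1 ⟨i, rfl⟩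
  let P : Fin 6 → Fin 3 → Bool := fun i => φ ⟨F i, hmem i⟩
  have hP : ∀ i j, C6.Adj i j → cubeGraph.Adj (P i) (P j) := fun i j hij =>
    φ.map_rel_iff.mpr (hF i j hij)
  have hPne : ∀ i, P i ≠ P (i + 1 + 1) := by
    intro i h
    have h' : F i = F (i + 1 + 1) := congrArg Subtype.val (φ.injective h)
    have := h2 i
    rw [← h', SimpleGraph.dist_self] at this
    omega
  obtain ⟨z, hz0, hz2, hz4⟩ := cubeGraph_common_nbr (P 0) (P 2) (P 4) (P 1) (P 5)
    (hPne 0) (hPne 4).symm (hPne 2) (hP _ _ (hC1 0)) (hP _ _ (hC1 1).symm) (hP _ _ (hC1 5).symm) (hP _ _ (hC1 4))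
  have key : ∀ i, cubeGraph.Adj z (P i) → X.Adj (φ.symm z).1 (F i) := by
    intro i hi
    have : cubeGraph.Adj (φ (φ.symm z)) (P i) := by rwa [RelIso.apply_symm_apply]
    exact φ.map_rel_iff.mp this
  exact ⟨(φ.symm z).1, key 0 hz0, key 2 hz2, key 4 hz4⟩

lemma IsQuasiMedian.quadrangle_aux (hX : IsQuasiMedian X) {u v w z a : V} (hzv : X.Adj z v)
    (hzw : X.Adj z w) (hne : v ≠ w) (hvw : ¬ X.Adj v w) (h : X.dist u v = X.dist u w)
    (hz : X.dist u z = X.dist u v + 1) (hav : X.Adj a v) (hua : X.dist u a + 1 = X.dist u v)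
    (haw : X.dist a w = 2) :
    ∃ x, X.Adj x v ∧ X.Adj x w ∧ X.dist u x + 1 = X.dist u v := by
  have hvw2 := hX.dist_eq_two hne hvw hzv.symm hzw
  obtain ⟨c, hca, hcv, hwc⟩ := hX.triangle_condition (u := w) hav
    (by rw [X.dist_comm, haw, X.dist_comm, hvw2])
  rw [X.dist_comm (u := w) (v := a), haw] at hwc
  have hcw : X.Adj c w := (SimpleGraph.dist_eq_one_iff_adj.mp (by omega : X.dist w c = 1)).symm
  have hzc : ¬ X.Adj z c := fun h' =>
    hvw (hX.adj_of_common h' hzv.symm hcv.symm hzw.symm hcw.symm hne)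
  have hca' := hX.dist_le_succ u hca
  have hvc := hX.dist_le_succ u hcv.symm
  by_cases hc : X.dist u c + 1 = X.dist u v
  · exact ⟨c, hcv, hcw, hc⟩
  have hc' : X.dist u c = X.dist u v := by omega
  obtain ⟨e, hec, hew, hue⟩ := hX.triangle_condition (u := u) hcw (by omega)
  have hzc' : z ≠ c := by rintro rfl; omega
  have hzc2 := hX.dist_eq_two hzc' hzc hzv hcv.symm
  have key : ∀ s t, X.Adj s z → X.Adj s c → X.Adj t s → X.Adj t c → X.dist u t + 1 = X.dist u c →
      IsQuasiMedianTriple X u z c (t, s, c) := by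
    intro s t hsz hsc hts htc hut
    have e1 := SimpleGraph.dist_eq_one_iff_adj.mpr hsz
    have e1' := SimpleGraph.dist_eq_one_iff_adj.mpr hsz.symm
    have e2 := SimpleGraph.dist_eq_one_iff_adj.mpr hsc
    have e3 := SimpleGraph.dist_eq_one_iff_adj.mpr hts
    have e4 := SimpleGraph.dist_eq_one_iff_adj.mpr htc
    have e5 : X.dist c c = 0 := SimpleGraph.dist_self
    refine ⟨1, ⟨?_, ?_, ?_, e3, e4, e2⟩, ?_⟩
    · simp only [OnGeod]; omega
    · simp only [OnGeod]; omega
    · simp only [OnGeod]; omega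
    · rintro k' z₁ z₂ z₃ ⟨g₁, g₂, g₃, f₁, f₂, f₃⟩
      simp only [OnGeod] at g₁ g₂ g₃
      have := X.dist_comm (u := z) (v := z₂)
      by_contra hk
      omega
  have := (hX.uniqueQuasiMedian u z c).unique
    (key v a hzv.symm hcv.symm hav hca.symm (by omega))
    (key w e hzw.symm hcw.symm hew hec (by omega))
  exact absurd (congrArg (fun t => t.2.1) this) hne

/-- The quadrangle condition. -/
lemma IsQuasiMedian.quadrangle_condition (hX : IsQuasiMedian X) {u v w z : V} (hzv : X.Adj z v)
    (hzw : X.Adj z w) (hne : v ≠ w) (hvw : ¬ X.Adj v w) (h : X.dist u v = X.dist u w)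
    (hz : X.dist u z = X.dist u v + 1) :
    ∃ x, X.Adj x v ∧ X.Adj x w ∧ X.dist u x + 1 = X.dist u v := by
  have hvw2 := hX.dist_eq_two hne hvw hzv.symm hzw
  obtain ⟨⟨y₁, y₂, y₃⟩, ⟨k, ⟨g₁, g₂, g₃, e₁, e₂, e₃⟩, -⟩, -⟩ := hX.uniqueQuasiMedian u v w
  simp only [OnGeod] at g₁ g₂ g₃ e₁ e₂ e₃
  have c1 := X.dist_comm (u := v) (v := y₂)
  have hk : k = 0 ∨ k = 2 := by omega
  rcases hk with rfl | rfl
  · obtain rfl := hX.connected.dist_eq_zero_iff.mp e₁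
    obtain rfl := hX.connected.dist_eq_zero_iff.mp e₂
    exact ⟨y₁, SimpleGraph.dist_eq_one_iff_adj.mp (by omega),
      SimpleGraph.dist_eq_one_iff_adj.mp (by omega), by omega⟩
  · obtain rfl := hX.connected.dist_eq_zero_iff.mp (by omega : X.dist v y₂ = 0)
    obtain rfl := hX.connected.dist_eq_zero_iff.mp (by omega : X.dist y₃ w = 0)
    have mid : ∀ t, X.dist y₁ t = 2 → ∃ a, X.Adj y₁ a ∧ X.Adj a t := by
      intro t ht
      obtain ⟨a, hat, ha⟩ := hX.exists_closer (u := y₁) (v := t) (fun h => by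
        rw [h, SimpleGraph.dist_self] at ht; omega)
      exact ⟨a, SimpleGraph.dist_eq_one_iff_adj.mp (by omega), hat⟩
    obtain ⟨a, hya, hav⟩ := mid v e₁
    obtain ⟨b, hyb, hbw⟩ := mid y₃ e₂
    have hvv : X.dist v v = 0 := SimpleGraph.dist_self
    have hww : X.dist y₃ y₃ = 0 := SimpleGraph.dist_self
    have hua := hX.dist_le_succ u hya.symm
    have hub := hX.dist_le_succ u hyb.symm
    have hua' := hX.dist_le_succ u hav.symm
    have hub' := hX.dist_le_succ u hbw.symm
    have haw3 : X.dist a y₃ ≤ 3 := by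
      have := hX.dist_le_succ y₃ hya.symm
      have := X.dist_comm (u := a) (v := y₃)
      have := X.dist_comm (u := y₁) (v := y₃)
      omega
    have hbv3 : X.dist b v ≤ 3 := by
      have := hX.dist_le_succ v hyb.symm
      have := X.dist_comm (u := b) (v := v)
      have := X.dist_comm (u := y₁) (v := v)
      omega
    have hya1 := SimpleGraph.dist_eq_one_iff_adj.mpr hya
    have hyb1 := SimpleGraph.dist_eq_one_iff_adj.mpr hyb
    by_cases ha1 : X.dist a y₃ = 1
    · exact ⟨a, hav, SimpleGraph.dist_eq_one_iff_adj.mp ha1, by omega⟩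
    by_cases hb1 : X.dist b v = 1
    · exact ⟨b, SimpleGraph.dist_eq_one_iff_adj.mp hb1, hbw, by omega⟩
    by_cases ha2 : X.dist a y₃ = 2
    · exact hX.quadrangle_aux hzv hzw hne hvw h hz hav (by omega) ha2
    by_cases hb2 : X.dist b v = 2
    · obtain ⟨x, h1, h2, h3⟩ := hX.quadrangle_aux hzw hzv hne.symm (fun h => hvw h.symm) h.symm
        (by omega) hbw (by omega) hb2
      exact ⟨x, h2, h1, by omega⟩
    have ha0 : X.dist a y₃ ≠ 0 := by
      intro h0
      obtain rfl := hX.connected.dist_eq_zero_iff.mp h0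
      omega
    have hb0 : X.dist b v ≠ 0 := by
      intro h0
      obtain rfl := hX.connected.dist_eq_zero_iff.mp h0
      omega
    have hyz : X.dist y₁ z = 3 := by
      have h1 := hX.connected.dist_triangle (u := u) (v := y₁) (w := z)
      have h2 := hX.dist_le_succ y₁ hzv
      omega
    obtain ⟨x, hx1, hx2, hx3⟩ := hX.hexagon hya hav hzv.symm hzw hbw.symm hyb.symm hyz
      (by omega) (by rw [X.dist_comm]; omega)
    have := hX.dist_le_succ u hx1
    have := hX.dist_le_succ u hx2.symm
    exact ⟨x, hx2, hx3, by omega⟩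

end WeakModularity

section Gates

/-- `C` is a clique and `g` sends every vertex to its gate in `C`: the unique closest vertex,
all others being one step further. -/
structure CliqueGate (X : SimpleGraph V) (C : Set V) (g : V → V) : Prop where
  mem : ∀ v, g v ∈ C
  adj : ∀ z ∈ C, ∀ w ∈ C, z ≠ w → X.Adj z w
  dist_eq : ∀ v, ∀ w ∈ C, w ≠ g v → X.dist w v = X.dist (g v) v + 1

/-- Every edge lies in a gated clique. -/
lemma IsQuasiMedian.exists_cliqueGate (hX : IsQuasiMedian X) {x y : V} (hxy : X.Adj x y) :
    ∃ C g, CliqueGate X C g ∧ x ∈ C ∧ y ∈ C := by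
  let C : Set V := {z | z = x ∨ z = y ∨ (X.Adj z x ∧ X.Adj z y)}
  have hadj : ∀ z ∈ C, ∀ w ∈ C, z ≠ w → X.Adj z w := by
    rintro z (rfl | rfl | ⟨h1, h2⟩) w (rfl | rfl | ⟨h3, h4⟩) hne
    · exact absurd rfl hne
    · exact hxy
    · exact h3.symm
    · exact hxy.symm
    · exact absurd rfl hne
    · exact h4.symm
    · exact h1
    · exact h2
    · exact hX.adj_of_common hxy h1 h2 h3 h4 hne
  have hmax : ∀ z ∈ C, ∀ w ∈ C, z ≠ w → ∀ t, X.Adj t z → X.Adj t w → t ∈ C := by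
    intro z hz w hw hzw t htz htw
    have key : ∀ c ∈ C, t ≠ c → X.Adj t c := by
      intro c hc hne
      by_cases hcz : c = z
      · rwa [hcz]
      by_cases hcw : c = w
      · rwa [hcw]
      exact hX.adj_of_common (hadj z hz w hw hzw) htz htw (hadj c hc z hz hcz)
        (hadj c hc w hw hcw) hne
    by_cases h1 : t = x
    · exact Or.inl h1
    by_cases h2 : t = y
    · exact Or.inr (Or.inl h2)
    exact Or.inr (Or.inr ⟨key x (Or.inl rfl) h1, key y (Or.inr (Or.inl rfl)) h2⟩)
  have hgate : ∀ v, ∃ z ∈ C, ∀ w ∈ C, w ≠ z → X.dist w v = X.dist z v + 1 := by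
    intro v
    obtain ⟨z, hz, hmin⟩ := (measure fun z => X.dist z v).wf.has_min C ⟨x, Or.inl rfl⟩
    refine ⟨z, hz, fun w hw hwz => ?_⟩
    have h1 : ¬ X.dist w v < X.dist z v := hmin w hw
    have h2 := hX.dist_le_succ v (hadj w hw z hz hwz)
    rw [X.dist_comm, X.dist_comm (u := v)] at h2
    by_contra hne
    obtain ⟨t, htz, htw, ht⟩ := hX.triangle_condition (u := v) (hadj z hz w hw hwz.symm)
      (by rw [X.dist_comm, X.dist_comm (u := v)]; omega)
    have h3 : ¬ X.dist t v < X.dist z v := hmin t (hmax z hz w hw hwz.symm t htz htw)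
    rw [X.dist_comm, X.dist_comm (u := v)] at ht
    omega
  choose g hg using hgate
  exact ⟨C, g, ⟨fun v => (hg v).1, hadj, fun v => (hg v).2⟩, Or.inl rfl, Or.inr (Or.inl rfl)⟩

variable {C : Set V} {g : V → V}

lemma CliqueGate.dist_le (hg : CliqueGate X C g) (v : V) {z : V} (hz : z ∈ C) :
    X.dist z v ≤ X.dist (g v) v + 1 := by
  by_cases h : z = g v
  · rw [h]; omega
  · rw [hg.dist_eq v z hz h]

lemma CliqueGate.le_dist (hg : CliqueGate X C g) (v : V) {z : V} (hz : z ∈ C) :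
    X.dist (g v) v ≤ X.dist z v := by
  by_cases h : z = g v
  · rw [h]
  · rw [hg.dist_eq v z hz h]; omega

lemma CliqueGate.eq_of_dist_lt (hg : CliqueGate X C g) {v z w : V} (hz : z ∈ C) (hw : w ∈ C)
    (h : X.dist z v < X.dist w v) : g v = z := by
  by_contra hne
  have := hg.dist_eq v z hz (Ne.symm hne)
  have := hg.dist_le v hw
  omega

lemma CliqueGate.self_eq (hX : IsQuasiMedian X) (hg : CliqueGate X C g) {v : V} (hv : v ∈ C) :
    g v = v := by
  have h := hg.le_dist v hv
  rw [SimpleGraph.dist_self] at h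
  exact hX.connected.dist_eq_zero_iff.mp (by omega)

lemma CliqueGate.level_eq (hX : IsQuasiMedian X) (hg : CliqueGate X C g) {u v : V}
    (huv : X.Adj u v) (hne : g u ≠ g v) : X.dist (g u) u = X.dist (g v) v := by
  have h1 := hg.dist_eq u (g v) (hg.mem v) hne.symm
  have h2 := hg.dist_eq v (g u) (hg.mem u) hne
  have h3 := hX.dist_le_succ (g v) huv
  have h4 := hX.dist_le_succ (g u) huv.symm
  omega

lemma CliqueGate.gate_eq_of_closer (hX : IsQuasiMedian X) (hg : CliqueGate X C g) {u u' : V}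
    (hu : X.Adj u' u) (h : X.dist (g u) u' + 1 = X.dist (g u) u) : g u' = g u := by
  by_contra hne
  have h1 := hg.dist_eq u' (g u) (hg.mem u) (Ne.symm hne)
  have h2 := hX.dist_le_succ (g u') hu.symm
  have h3 := hg.le_dist u (hg.mem u')
  omega

/-- An edge with distinct gates can be pushed towards the clique through a square. -/
lemma CliqueGate.descend (hX : IsQuasiMedian X) (hg : CliqueGate X C g) {u v u' : V}
    (huv : X.Adj u v) (hne : g u ≠ g v) (hu : X.Adj u' u)
    (h : X.dist (g u) u' + 1 = X.dist (g u) u) :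
    g u' = g u ∧ ∃ v', X.Adj v' v ∧ X.Adj v' u' ∧ g v' = g v ∧
      X.dist (g v) v' + 1 = X.dist (g v) v := by
  have hgu := hg.gate_eq_of_closer hX hu h
  refine ⟨hgu, ?_⟩
  have hl := hg.level_eq hX huv hne
  have h1 := hg.dist_eq u (g v) (hg.mem v) hne.symm
  have h2 := hg.dist_eq v (g u) (hg.mem u) hne
  have h3 := hg.dist_eq u' (g v) (hg.mem v) (by rw [hgu]; exact hne.symm)
  rw [hgu] at h3
  have hvu' : v ≠ u' := by rintro rfl; omega
  have hvu : ¬ X.Adj v u' := fun h' => by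
    have := hX.dist_le_succ (g u) h'
    omega
  obtain ⟨x, hxv, hxu, hx⟩ := hX.quadrangle_condition (u := g v) huv hu.symm hvu' hvu
    (by omega) (by omega)
  exact ⟨x, hxv, hxu, hg.gate_eq_of_closer hX hxv hx, hx⟩

lemma CliqueGate.ne_of_triangle (hX : IsQuasiMedian X) (hg : CliqueGate X C g) {a b c : V}
    (hab : X.Adj a b) (hac : X.Adj a c) (hbc : X.Adj b c) (hne : g a ≠ g b) : g a ≠ g c := by
  intro heq
  have h1 := hg.level_eq hX hab hne
  have h2 := hg.level_eq hX hbc (by rw [← heq]; exact hne.symm)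
  have h3 := hg.dist_eq b (g a) (hg.mem a) hne
  rw [← heq] at h2
  obtain ⟨w, hwa, hwc, hw⟩ := hX.triangle_condition (u := g a) hac (by omega)
  have hwb : w ≠ b := by rintro rfl; omega
  have := hX.dist_le_succ (g a) (hX.adj_of_common hac hwa hwc hab.symm hbc hwb).symm
  omega

lemma CliqueGate.square_aux (hX : IsQuasiMedian X) (hg : CliqueGate X C g) {a b c d : V}
    (hab : X.Adj a b) (hcd : X.Adj c d) (hac : X.Adj a c) (hbd : X.Adj b d) (had : a ≠ d)
    (hbc : b ≠ c) (had' : ¬ X.Adj a d) (hbc' : ¬ X.Adj b c) (hne : g a ≠ g b)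
    (hca : g c = g a) (hda : g d = g a) : False := by
  have h1 := hg.level_eq hX hab hne
  have h2 := hg.level_eq hX hbd (by rw [hda]; exact hne.symm)
  have h3 := hg.dist_eq b (g a) (hg.mem a) hne
  have h4 := hg.dist_eq a (g b) (hg.mem b) hne.symm
  have h5 := hg.dist_eq c (g b) (hg.mem b) (by rw [hca]; exact hne.symm)
  have h6 := hg.dist_eq d (g b) (hg.mem b) (by rw [hda]; exact hne.symm)
  rw [hca] at h5
  rw [hda] at h2 h6
  obtain ⟨s, hsa, hsd, hs⟩ := hX.quadrangle_condition (u := g a) hab.symm hbd had had'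
    (by omega) (by omega)
  rcases hX.common_nbrs had had' hab hac hsa.symm hbd.symm hcd.symm hsd.symm with e | e | rfl
  · exact hbc e
  · subst e; omega
  obtain ⟨t, htb, htc, ht⟩ := hX.quadrangle_condition (u := g b) hab hac hbc hbc'
    (by omega) (by omega)
  rcases hX.common_nbrs hbc hbc' hab.symm hbd htb.symm hac.symm hcd htc.symm with e | e | rfl
  · exact had e
  · subst e; omega
  · omega

/-- Opposite sides of a square simultaneously have distinct gates. -/
lemma CliqueGate.ne_of_square (hX : IsQuasiMedian X) (hg : CliqueGate X C g) {a b c d : V}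
    (hab : X.Adj a b) (hcd : X.Adj c d) (hac : X.Adj a c) (hbd : X.Adj b d) (had : a ≠ d)
    (hbc : b ≠ c) (hne : g a ≠ g b) : g c ≠ g d := by
  by_cases hbc' : X.Adj b c
  · have := hg.ne_of_triangle hX hab.symm hbc' hac hne.symm
    exact hg.ne_of_triangle hX hbc'.symm hcd hbd this.symm
  by_cases had' : X.Adj a d
  · have := hg.ne_of_triangle hX hab had' hbd hne
    exact (hg.ne_of_triangle hX had'.symm hcd.symm hac this.symm).symm
  intro heq
  by_cases hca : g c = g a
  · exact hg.square_aux hX hab hcd hac hbd had hbc had' hbc' hne hca (heq ▸ hca)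
  by_cases hcb : g c = g b
  · exact hg.square_aux hX hab.symm hcd.symm hbd hac hbc had hbc' had' hne.symm (heq ▸ hcb) hcb
  have l1 := hg.level_eq hX hab hne
  have l2 := hg.level_eq hX hac (Ne.symm hca)
  have l3 := hg.level_eq hX hbd (by rw [← heq]; exact Ne.symm hcb)
  rw [← heq] at l3
  have h1 := hg.dist_eq a (g c) (hg.mem c) hca
  have h2 := hg.dist_eq b (g c) (hg.mem c) hcb
  have h3 := hg.dist_eq c (g a) (hg.mem a) (Ne.symm hca)
  have h4 := hg.dist_eq b (g a) (hg.mem a) hne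
  obtain ⟨w, hwc, hwd, hw⟩ := hX.triangle_condition (u := g c) hcd (by omega)
  obtain ⟨-, a', ha₁a, ha₁w, -, ha'⟩ := hg.descend hX hac.symm hca hwc hw
  have hwa : ¬ X.Adj w a := fun h => by
    have := hX.dist_le_succ (g c) h.symm
    omega
  have hwb : ¬ X.Adj w b := fun h => by
    have := hX.dist_le_succ (g c) h.symm
    omega
  have hwa' : w ≠ a := by rintro rfl; omega
  have hwb' : w ≠ b := by rintro rfl; omega
  have dwa := hX.dist_eq_two hwa' hwa hwc hac.symm
  have dwb := hX.dist_eq_two hwb' hwb hwd hbd.symm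
  obtain ⟨q, hqa, hqb, hq⟩ := hX.triangle_condition (u := w) hab (by omega)
  have hwq : X.Adj w q := SimpleGraph.dist_eq_one_iff_adj.mp (by omega)
  rcases hX.common_nbrs hwa' hwa hwc hwq ha₁w.symm hac hqa.symm ha₁a.symm with rfl | rfl | rfl
  · exact hbc' hqb.symm
  · omega
  · have := hX.dist_le_succ (g a) hqb.symm
    omega

/-- The edge `e` joins vertices with distinct gates. -/
def SplitEdge (X : SimpleGraph V) (g : V → V) (e : Sym2 V) : Prop :=
  ∃ u v, e = s(u, v) ∧ X.Adj u v ∧ g u ≠ g v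

lemma splitEdge_mk {a b : V} : SplitEdge X g s(a, b) ↔ X.Adj a b ∧ g a ≠ g b := by
  constructor
  · rintro ⟨u, v, he, huv, hne⟩
    rcases Sym2.eq_iff.mp he with ⟨rfl, rfl⟩ | ⟨rfl, rfl⟩
    · exact ⟨huv, hne⟩
    · exact ⟨huv.symm, hne.symm⟩
  · exact fun h => ⟨a, b, rfl, h⟩

lemma CliqueGate.splitEdge_iff (hX : IsQuasiMedian X) (hg : CliqueGate X C g) {e f : Sym2 V}
    (h : Relation.EqvGen (SideRel X) e f) : SplitEdge X g e ↔ SplitEdge X g f := by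
  induction h with
  | rel e f h =>
    rcases h with ⟨a, b, c, hab, hac, hbc, rfl, rfl⟩ |
      ⟨a, b, c, d, hab, hcd, hac, hbd, had, hbc, rfl, rfl⟩
    · rw [splitEdge_mk, splitEdge_mk]
      exact ⟨fun h => ⟨hac, hg.ne_of_triangle hX hab hac hbc h.2⟩,
        fun h => ⟨hab, hg.ne_of_triangle hX hac hab hbc.symm h.2⟩⟩
    · rw [splitEdge_mk, splitEdge_mk]
      exact ⟨fun h => ⟨hcd, hg.ne_of_square hX hab hcd hac hbd had hbc h.2⟩,
        fun h => ⟨hab, hg.ne_of_square hX hcd hab hac.symm hbd.symm hbc.symm had.symm h.2⟩⟩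
  | refl e => rfl
  | symm e f _ ih => exact ih.symm
  | trans e f k _ _ ih1 ih2 => exact ih1.trans ih2

lemma eqvGen_of_common_vertex {a b c : V} (hab : X.Adj a b) (hac : X.Adj a c)
    (hbc : b = c ∨ X.Adj b c) : Relation.EqvGen (SideRel X) s(a, b) s(a, c) := by
  rcases hbc with rfl | hbc
  · exact .refl _
  · exact .rel _ _ (Or.inl ⟨a, b, c, hab, hac, hbc, rfl, rfl⟩)

lemma CliqueGate.eqvGen_of_mem (hg : CliqueGate X C g) {x y u v : V} (hx : x ∈ C) (hy : y ∈ C)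
    (hu : u ∈ C) (hv : v ∈ C) (hxy : x ≠ y) (huv : u ≠ v) :
    Relation.EqvGen (SideRel X) s(x, y) s(u, v) := by
  have hor : ∀ a ∈ C, ∀ b ∈ C, a = b ∨ X.Adj a b := fun a ha b hb =>
    or_iff_not_imp_left.mpr (hg.adj a ha b hb)
  by_cases hux : u = x
  · subst hux
    exact eqvGen_of_common_vertex (hg.adj _ hx _ hy hxy) (hg.adj _ hu _ hv huv) (hor _ hy _ hv)
  · have h1 := eqvGen_of_common_vertex (hg.adj _ hx _ hy hxy)
      (hg.adj _ hx _ hu (Ne.symm hux)) (hor _ hy _ hu)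
    have h2 := eqvGen_of_common_vertex (hg.adj _ hu _ hx hux) (hg.adj _ hu _ hv huv)
      (hor _ hx _ hv)
    rw [Sym2.eq_swap] at h2
    exact h1.trans _ _ _ h2

lemma CliqueGate.eqvGen_of_gate_ne (hX : IsQuasiMedian X) (hg : CliqueGate X C g) {x y : V}
    (hx : x ∈ C) (hy : y ∈ C) (hxy : x ≠ y) (n : ℕ) :
    ∀ u v : V, X.dist (g u) u = n → X.Adj u v → g u ≠ g v →
      Relation.EqvGen (SideRel X) s(x, y) s(u, v) := by
  induction n with
  | zero =>
    intro u v hu huv hne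
    have hv := hg.level_eq hX huv hne
    have eu := hX.connected.dist_eq_zero_iff.mp hu
    have ev := hX.connected.dist_eq_zero_iff.mp (hv.symm.trans hu)
    exact hg.eqvGen_of_mem hx hy (eu ▸ hg.mem u) (ev ▸ hg.mem v) hxy huv.ne
  | succ n ih =>
    intro u v hu huv hne
    obtain ⟨u', h1, hd⟩ := hX.exists_closer (u := g u) (v := u) (fun h => by
      rw [h, SimpleGraph.dist_self] at hu; omega)
    obtain ⟨e1, v', hv', hvu', e2, hdv⟩ := hg.descend hX huv hne h1 hd
    refine (ih u' v' (by rw [e1]; omega) hvu'.symm (by rw [e1, e2]; exact hne)).trans _ _ _ ?_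
    refine .rel _ _ (Or.inr ⟨u', v', u, v, hvu'.symm, huv, h1, hv', ?_, ?_, rfl, rfl⟩)
    · rintro rfl; exact hne e1.symm
    · rintro rfl; exact hne e2

/-- A hyperplane through an edge of a gated clique consists of the edges with distinct gates. -/
lemma CliqueGate.mem_hyperplane_iff (hX : IsQuasiMedian X) (hg : CliqueGate X C g) {x y : V}
    (hx : x ∈ C) (hy : y ∈ C) (hxy : x ≠ y) (u v : V) :
    s(u, v) ∈ hypClass X s(x, y) ↔ X.Adj u v ∧ g u ≠ g v := by
  constructor
  · intro h
    rw [← splitEdge_mk, ← hg.splitEdge_iff hX h, splitEdge_mk, hg.self_eq hX hx,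
      hg.self_eq hX hy]
    exact ⟨hg.adj x hx y hy hxy, hxy⟩
  · exact fun h => hg.eqvGen_of_gate_ne hX hx hy hxy _ u v rfl h.1 h.2

end Gates

section Carriers

variable {C : Set V} {g : V → V}

/-- `v` is an endpoint of an edge with distinct gates. -/
def Splits (X : SimpleGraph V) (g : V → V) (v : V) : Prop :=
  ∃ u, X.Adj v u ∧ g v ≠ g u

lemma Splits.gate_eq_of_not {c v : V} (hc : ¬ Splits X g c) (h : X.Adj c v) : g c = g v := by
  by_contra hne
  exact hc ⟨v, h, hne⟩

lemma CliqueGate.exists_adj_gate_eq (hX : IsQuasiMedian X) (hg : CliqueGate X C g) {v y : V}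
    (hv : Splits X g v) (hy : y ∈ C) (hne : y ≠ g v) : ∃ u, X.Adj v u ∧ g u = y := by
  obtain ⟨u, hvu, hgu⟩ := hv
  by_cases huy : g u = y
  · exact ⟨u, hvu, huy⟩
  have h1 := hg.dist_eq v y hy hne
  have h2 := hg.dist_eq u y hy (Ne.symm huy)
  have h3 := hg.level_eq hX hvu hgu
  obtain ⟨t, htv, htu, ht⟩ := hX.triangle_condition (u := y) hvu (by omega)
  refine ⟨t, htv.symm, ?_⟩
  by_contra hty
  have h4 := hg.dist_eq t y hy (Ne.symm hty)
  have h5 := hg.level_eq hX htv.symm (hg.ne_of_triangle hX hvu htv.symm htu.symm hgu)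
  omega

lemma CliqueGate.adj_gate_unique (hX : IsQuasiMedian X) (hg : CliqueGate X C g) {v a b : V}
    (ha : X.Adj v a) (hb : X.Adj v b) (hab : g a = g b) (hne : g v ≠ g a) : a = b := by
  by_contra hab'
  by_cases hadj : X.Adj a b
  · exact hg.ne_of_triangle hX ha.symm hadj hb hne.symm hab
  have h1 := hg.level_eq hX ha hne
  have h2 := hg.level_eq hX hb (by rw [← hab]; exact hne)
  have h3 := hg.dist_eq v (g a) (hg.mem a) hne.symm
  rw [← hab] at h2
  obtain ⟨r, hra, hrb, hr⟩ := hX.quadrangle_condition (u := g a) ha hb hab' hadj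
    (by omega) (by omega)
  obtain ⟨-, s, hsv, hsr, hgs, -⟩ := hg.descend hX ha.symm hne.symm hra hr
  have hrv : r ≠ v := by rintro rfl; omega
  have hrv' : ¬ X.Adj r v := fun h => by
    have := hX.dist_le_succ (g a) h.symm
    omega
  rcases hX.common_nbrs hrv hrv' hra hrb hsr.symm ha hb hsv.symm with e | rfl | rfl
  · exact hab' e
  · exact hne hgs.symm
  · exact hne (hgs.symm.trans hab.symm)

lemma CliqueGate.splits_of_ladder (hX : IsQuasiMedian X) (hg : CliqueGate X C g)
    {a b c a' b' : V} (hca : X.Adj c a) (hcb : X.Adj c b) (ha : X.Adj a' a) (hb : X.Adj b' b)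
    (hab' : X.Adj a' b') (hgab : g a' = g b') (hne : g a ≠ g a') : Splits X g c := by
  by_contra hc
  have h1 := Splits.gate_eq_of_not hc hca
  have key : ∀ t, X.Adj c t → g t ≠ g a' := fun t ht => by
    rw [← Splits.gate_eq_of_not hc ht, h1]; exact hne
  have hca' : c ≠ a' := by rintro rfl; exact hne h1.symm
  have hcb' : c ≠ b' := by rintro rfl; exact hne (h1.symm.trans hgab.symm)
  have d1 := hX.dist_eq_two hca' (fun h => key _ h rfl) hca ha.symm
  have d2 := hX.dist_eq_two hcb' (fun h => key _ h hgab.symm) hcb hb.symm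
  obtain ⟨t, hta, htb, ht⟩ := hX.triangle_condition (u := c) hab' (by omega)
  have hct : X.Adj c t := SimpleGraph.dist_eq_one_iff_adj.mp (by omega)
  exact hg.ne_of_triangle hX hta.symm hab' htb (key t hct).symm hgab

lemma CliqueGate.splits_of_triangle (hX : IsQuasiMedian X) (hg : CliqueGate X C g) {a b c : V}
    (hab : X.Adj a b) (hca : X.Adj c a) (hcb : X.Adj c b) (ha : Splits X g a)
    (hb : Splits X g b) : Splits X g c := by
  by_contra hc
  have h1 := Splits.gate_eq_of_not hc hca
  have h2 := Splits.gate_eq_of_not hc hcb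
  have hgab : g a = g b := h1.symm.trans h2
  have step : ∀ a b, X.Adj a b → X.Adj c a → X.Adj c b → Splits X g a → g a = g b →
      X.dist (g a) b + 1 = X.dist (g a) a → False := by
    rintro a b hab hca hcb ⟨a', haa', hne⟩ hgab hd
    obtain ⟨-, b', hb₁a₁, hb₁b, hgb', -⟩ := hg.descend hX haa' hne hab.symm hd
    exact hc (hg.splits_of_ladder hX hca hcb haa'.symm hb₁b hb₁a₁.symm hgb'.symm hne)
  have l1 := hX.dist_le_succ (g a) hab
  have l2 := hX.dist_le_succ (g a) hab.symm
  by_cases e1 : X.dist (g a) b + 1 = X.dist (g a) a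
  · exact step a b hab hca hcb ha hgab e1
  by_cases e2 : X.dist (g a) a + 1 = X.dist (g a) b
  · exact step b a hab.symm hcb hca hb hgab.symm (by rw [← hgab]; exact e2)
  obtain ⟨t, hta, htb, ht⟩ := hX.triangle_condition (u := g a) hab (by omega)
  obtain ⟨a', haa', hne⟩ := id ha
  obtain ⟨hgt, t', ht₁a₁, ht₁t, hgt', -⟩ := hg.descend hX haa' hne hta ht
  by_cases hct : c = t
  · subst hct
    exact hc ⟨t', ht₁t.symm, by rw [hgt, hgt']; exact hne⟩
  exact step a t hta.symm hca (hX.adj_of_common hab hca hcb hta htb hct) ha hgt.symm ht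

lemma CliqueGate.level_of_not_splits (hX : IsQuasiMedian X) (hg : CliqueGate X C g) {a c : V}
    (hca : X.Adj c a) (ha : Splits X g a) (hc : ¬ Splits X g c) :
    g a = g c ∧ X.dist (g c) a + 1 = X.dist (g c) c := by
  have h1 := Splits.gate_eq_of_not hc hca
  refine ⟨h1.symm, ?_⟩
  have l1 := hX.dist_le_succ (g c) hca
  have l2 := hX.dist_le_succ (g c) hca.symm
  obtain ⟨a', haa', hne⟩ := id ha
  by_contra hd
  by_cases hd' : X.dist (g c) c + 1 = X.dist (g c) a
  · obtain ⟨-, c', -, hc₁c, hgc', -⟩ := hg.descend hX haa' hne hca (by rw [← h1]; exact hd')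
    exact hc ⟨c', hc₁c.symm, by rw [h1, hgc']; exact hne⟩
  obtain ⟨t, htc, hta, ht⟩ := hX.triangle_condition (u := g c) hca (by omega)
  obtain ⟨hgt, t', -, ht₁t, hgt', -⟩ := hg.descend hX haa' hne hta (by rw [← h1]; omega)
  exact hc (hg.splits_of_triangle hX hta.symm hca htc.symm ha
    ⟨t', ht₁t.symm, by rw [hgt, hgt']; exact hne⟩)

lemma CliqueGate.dist_eq_three (hX : IsQuasiMedian X) (hg : CliqueGate X C g)
    {a b c s b' : V} (hab : a ≠ b) (hadj : ¬ X.Adj a b) (hca : X.Adj c a) (hcb : X.Adj c b)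
    (hsa : X.Adj s a) (hsb : X.Adj s b) (hsc : s ≠ c) (hb' : X.Adj b' b)
    (hgc : g c = g b) (hgs : g s = g b) (hne : g b ≠ g b') : X.dist a b' = 3 := by
  have dab := hX.dist_eq_two hab hadj hca.symm hcb
  have h1 := hX.dist_le_succ a hb'
  have h2 := hX.dist_le_succ a hb'.symm
  have key : ∀ r, X.Adj r a → X.Adj r b → g b = g r := by
    intro r hra hrb
    rcases hX.common_nbrs hab hadj hsa.symm hca.symm hra.symm hsb.symm hcb.symm hrb.symm with
      e | rfl | rfl
    · exact absurd e hsc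
    · exact hgs.symm
    · exact hgc.symm
  have h3 : X.dist a b' ≠ 1 := fun h =>
    hne (key b' (SimpleGraph.dist_eq_one_iff_adj.mp h).symm hb')
  have h4 : X.dist a b' ≠ 2 := by
    intro h
    obtain ⟨r, hrb, hrb', hr⟩ := hX.triangle_condition (u := a) hb'.symm (by omega)
    have har : X.Adj a r := SimpleGraph.dist_eq_one_iff_adj.mp (by omega)
    exact hg.ne_of_triangle hX hb'.symm hrb.symm hrb'.symm hne (key r har.symm hrb)
  omega

/-- The carrier of a hyperplane contains every vertex having two neighbours in it. -/
lemma CliqueGate.splits_of_two_nbrs (hX : IsQuasiMedian X) (hg : CliqueGate X C g) {a b c : V}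
    (hab : a ≠ b) (hca : X.Adj c a) (hcb : X.Adj c b) (ha : Splits X g a) (hb : Splits X g b) :
    Splits X g c := by
  by_cases hadj : X.Adj a b
  · exact hg.splits_of_triangle hX hadj hca hcb ha hb
  by_contra hc
  obtain ⟨hga, la⟩ := hg.level_of_not_splits hX hca ha hc
  obtain ⟨hgb, lb⟩ := hg.level_of_not_splits hX hcb hb hc
  obtain ⟨s, hsa, hsb, hs⟩ := hX.quadrangle_condition (u := g c) hca hcb hab hadj
    (by omega) (by omega)
  obtain ⟨a', haa', hne⟩ := id ha
  obtain ⟨b', hbb', hgb'⟩ := hg.exists_adj_gate_eq hX hb (hg.mem a') (by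
    rw [hgb, ← hga]; exact hne.symm)
  have hneb : g b ≠ g b' := by rw [hgb', hgb, ← hga]; exact hne
  obtain ⟨hgs, s', hs₁a₁, hs₁s, hgs', ds'⟩ := hg.descend hX haa' hne hsa (by rw [hga]; exact hs)
  obtain ⟨-, s'', hs₂b₁, hs₂s, hgs'', -⟩ :=
    hg.descend hX hbb' hneb hsb (by rw [hgb]; omega)
  obtain rfl : s' = s'' := hg.adj_gate_unique hX hs₁s.symm hs₂s.symm
    (by rw [hgs', hgs'', hgb']) (by rw [hgs, hgs']; exact hne)
  have hsc : s ≠ c := by rintro rfl; omega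
  have d1 : X.dist a b' = 3 := hg.dist_eq_three hX hab hadj hca hcb hsa hsb hsc hbb'.symm
    hgb.symm (hgs.trans (hga.trans hgb.symm)) hneb
  have d2 : X.dist b a' = 3 := hg.dist_eq_three hX hab.symm (fun h => hadj h.symm) hcb hca hsb
    hsa hsc haa'.symm hga.symm hgs hne
  have d3 : X.dist c s' = 3 := by
    have e1 := hg.level_eq hX haa' hne
    have e2 := hg.dist_eq c (g a') (hg.mem a') (by rw [← hga]; exact hne.symm)
    have e3 := hX.connected.dist_triangle (u := g a') (v := s') (w := c)
    rw [X.dist_comm (u := s')] at e3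
    have e4 := hX.dist_le_succ c hs₁s
    have e5 := hX.dist_le_succ c hsa
    have e6 := SimpleGraph.dist_eq_one_iff_adj.mpr hca
    rw [hga] at e1
    omega
  obtain ⟨e, hec, hea', heb'⟩ := hX.hexagon hca haa' hs₁a₁.symm hs₂b₁ hbb'.symm hcb.symm d3 d1
    (by rw [X.dist_comm]; exact d2)
  have hge := Splits.gate_eq_of_not hc hec.symm
  obtain rfl : e = a := hg.adj_gate_unique hX hea'.symm haa'.symm (by rw [← hge, hga])
    (by rw [← hge, ← hga]; exact hne.symm)
  have := SimpleGraph.dist_eq_one_iff_adj.mpr heb'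
  omega

end Carriers

section GatedSets

/-- `v` is the end of a path of length `k` from `q` whose later vertices lie in `S`. -/
def PathIn (X : SimpleGraph V) (S : Set V) (q : V) : ℕ → V → Prop
  | 0, v => v = q
  | k + 1, v => v ∈ S ∧ ∃ u, PathIn X S q k u ∧ X.Adj u v

lemma PathIn.mem {S : Set V} {q : V} (hq : q ∈ S) {k : ℕ} {v : V} (h : PathIn X S q k v) :
    v ∈ S := by
  cases k with
  | zero => exact (h : v = q) ▸ hq
  | succ k => exact h.1

lemma PathIn.dist_le (hX : IsQuasiMedian X) {S : Set V} {q : V} (p : V) {k : ℕ} :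
    ∀ {v : V}, PathIn X S q k v → X.dist p v ≤ X.dist p q + k := by
  induction k with
  | zero => intro v h; rw [(h : v = q)]; omega
  | succ k ih =>
    rintro v ⟨-, u, hu, huv⟩
    have h1 := ih hu
    have h2 := hX.dist_le_succ p huv.symm
    omega

lemma PathIn.pred (hX : IsQuasiMedian X) {S : Set V}
    (hS : ∀ a b c, a ≠ b → X.Adj c a → X.Adj c b → a ∈ S → b ∈ S → c ∈ S) {p q : V}
    (hq : q ∈ S) (hmin : ∀ v ∈ S, X.dist p q ≤ X.dist p v) (k : ℕ) :
    ∀ v w, PathIn X S q k v → X.dist p v = X.dist p q + k → w ∈ S → X.Adj w v →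
      X.dist p w + 1 = X.dist p v → ∃ j, j + 1 = k ∧ PathIn X S q j w := by
  induction k with
  | zero =>
    intro v w _ hd hw _ hd'
    have := hmin w hw
    omega
  | succ k ih =>
    rintro v w ⟨-, u, hu, huv⟩ hd hw hwv hd'
    refine ⟨k, rfl, ?_⟩
    have h1 := PathIn.dist_le hX p hu
    have h2 := hX.dist_le_succ p huv.symm
    by_cases huw : u = w
    · rwa [← huw]
    obtain ⟨t, htu, htw, ht⟩ : ∃ t, X.Adj t u ∧ X.Adj t w ∧ X.dist p t + 1 = X.dist p u := by
      by_cases hadj : X.Adj u w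
      · exact hX.triangle_condition hadj (by omega)
      · exact hX.quadrangle_condition huv.symm hwv.symm huw hadj (by omega) (by omega)
    have htS : t ∈ S := hS u w t huw htu htw (hu.mem hq) hw
    obtain ⟨j, rfl, hj⟩ := ih u t hu (by omega) htS htu ht
    exact ⟨hw, t, hj, htw⟩

lemma PathIn.exists_geodesic (hX : IsQuasiMedian X) {S : Set V}
    (hS : ∀ a b c, a ≠ b → X.Adj c a → X.Adj c b → a ∈ S → b ∈ S → c ∈ S) {p q : V}
    (hq : q ∈ S) (hmin : ∀ v ∈ S, X.dist p q ≤ X.dist p v) (k : ℕ) :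
    ∀ v, PathIn X S q k v → ∃ j, PathIn X S q j v ∧ X.dist p v = X.dist p q + j := by
  induction k with
  | zero =>
    intro v h
    exact ⟨0, h, by rw [(h : v = q)]; omega⟩
  | succ k ih =>
    rintro v ⟨hv, u, hu, huv⟩
    obtain ⟨j, hj, hd⟩ := ih u hu
    have h1 := hX.dist_le_succ p huv
    have h2 := hX.dist_le_succ p huv.symm
    by_cases e1 : X.dist p v = X.dist p u + 1
    · exact ⟨j + 1, ⟨hv, u, hj, huv⟩, by omega⟩
    by_cases e2 : X.dist p v + 1 = X.dist p u
    · obtain ⟨i, rfl, hi⟩ := PathIn.pred hX hS hq hmin j u v hj hd hv huv.symm e2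
      exact ⟨i, hi, by omega⟩
    obtain ⟨t, htu, htv, ht⟩ := hX.triangle_condition (u := p) huv (by omega)
    have htS : t ∈ S := hS u v t huv.ne htu htv (hu.mem hq) hv
    obtain ⟨i, rfl, hi⟩ := PathIn.pred hX hS hq hmin j u t hj hd htS htu ht
    exact ⟨i + 1, ⟨hv, t, hi, htv⟩, by omega⟩

/-- A connected set of vertices containing every vertex with two neighbours in it is gated. -/
lemma IsQuasiMedian.exists_gate (hX : IsQuasiMedian X) {S : Set V} (hne : S.Nonempty)
    (hS : ∀ a b c, a ≠ b → X.Adj c a → X.Adj c b → a ∈ S → b ∈ S → c ∈ S)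
    (hconn : ∀ v ∈ S, ∀ w ∈ S, Relation.ReflTransGen (fun a b => X.Adj a b ∧ b ∈ S) v w)
    (p : V) : ∃ q ∈ S, ∀ v ∈ S, X.dist p v = X.dist p q + X.dist q v := by
  obtain ⟨q, hq, hmin⟩ := (measure fun z => X.dist p z).wf.has_min S hne
  have hmin' : ∀ v ∈ S, X.dist p q ≤ X.dist p v := fun v hv => not_lt.mp (hmin v hv)
  refine ⟨q, hq, fun v hv => ?_⟩
  have hpath : ∃ k, PathIn X S q k v := by
    have hqv := hconn q hq v hv
    clear hv
    induction hqv with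
    | refl => exact ⟨0, rfl⟩
    | tail _ h ih =>
      obtain ⟨k, hk⟩ := ih
      exact ⟨k + 1, h.2, _, hk, h.1⟩
  obtain ⟨k, hk⟩ := hpath
  obtain ⟨j, hj, hd⟩ := PathIn.exists_geodesic hX hS hq hmin' k v hk
  have h1 := PathIn.dist_le hX q hj
  rw [SimpleGraph.dist_self] at h1
  have h2 := hX.connected.dist_triangle (u := p) (v := q) (w := v)
  omega

end GatedSets

section Hyperplanes

/-- The hyperplane dual to an edge. -/
def edgeHyperplane {a b : V} (h : X.Adj a b) : Hyperplane X :=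
  ⟨hypClass X s(a, b), s(a, b), h, rfl⟩

lemma mem_edgeHyperplane {a b : V} (h : X.Adj a b) : s(a, b) ∈ (edgeHyperplane h).1 :=
  Relation.EqvGen.refl _

lemma Hyperplane.eqvGen (H : Hyperplane X) {e f : Sym2 V} (he : e ∈ H.1) (hf : f ∈ H.1) :
    Relation.EqvGen (SideRel X) e f := by
  obtain ⟨e₀, -, h₀⟩ := H.2
  rw [h₀] at he hf
  exact (Relation.EqvGen.symm _ _ he).trans _ _ _ hf

lemma Hyperplane.mem_of_eqvGen (H : Hyperplane X) {e f : Sym2 V} (he : e ∈ H.1)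
    (h : Relation.EqvGen (SideRel X) e f) : f ∈ H.1 := by
  obtain ⟨e₀, -, h₀⟩ := H.2
  rw [h₀] at he ⊢
  exact Relation.EqvGen.trans _ _ _ he h

lemma Hyperplane.eq_of_mem {H K : Hyperplane X} {e : Sym2 V} (hH : e ∈ H.1) (hK : e ∈ K.1) :
    H = K := by
  apply Subtype.ext
  ext f
  exact ⟨fun hf => K.mem_of_eqvGen hK (H.eqvGen hH hf),
    fun hf => H.mem_of_eqvGen hH (K.eqvGen hK hf)⟩

lemma Hyperplane.exists_cliqueGate (hX : IsQuasiMedian X) (H : Hyperplane X) :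
    ∃ C g, CliqueGate X C g ∧ ∀ u v, s(u, v) ∈ H.1 ↔ X.Adj u v ∧ g u ≠ g v := by
  obtain ⟨_, ⟨x, y⟩, hxy, rfl⟩ := H
  obtain ⟨C, g, hg, hx, hy⟩ := hX.exists_cliqueGate hxy
  exact ⟨C, g, hg, hg.mem_hyperplane_iff hX hx hy (SimpleGraph.Adj.ne hxy)⟩

lemma Hyperplane.adj (hX : IsQuasiMedian X) (H : Hyperplane X) {u v : V}
    (h : s(u, v) ∈ H.1) : X.Adj u v := by
  obtain ⟨C, g, -, hH⟩ := H.exists_cliqueGate hX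
  exact ((hH u v).mp h).1

lemma mem_hypCarrier_iff {H : Hyperplane X} {v : V} :
    v ∈ hypCarrier X H ↔ ∃ u, s(v, u) ∈ H.1 := by
  constructor
  · rintro ⟨e, he, hv⟩
    obtain ⟨u, rfl⟩ := Sym2.mem_iff_exists.mp hv
    exact ⟨u, he⟩
  · rintro ⟨u, hu⟩
    exact ⟨_, hu, Sym2.mem_mk_left _ _⟩

/-- A step along an edge whose dual hyperplane equals or crosses `H`, ending in the carrier
of `H`. -/
def CarrierStep (H : Hyperplane X) (a b : V) : Prop :=
  X.Adj a b ∧ a ∈ hypCarrier X H ∧ b ∈ hypCarrier X H ∧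
    ∃ K : Hyperplane X, s(a, b) ∈ K.1 ∧ (K = H ∨ (crossingGraph X).Adj K H)

lemma CarrierStep.symm {H : Hyperplane X} {a b : V} (h : CarrierStep H a b) :
    CarrierStep H b a := by
  obtain ⟨h1, h2, h3, K, h4, h5⟩ := h
  exact ⟨h1.symm, h3, h2, K, Sym2.eq_swap ▸ h4, h5⟩

lemma CarrierStep.of_mem (hX : IsQuasiMedian X) {H : Hyperplane X} {a b : V}
    (h : s(a, b) ∈ H.1) : CarrierStep H a b :=
  ⟨H.adj hX h, mem_hypCarrier_iff.mpr ⟨b, h⟩, mem_hypCarrier_iff.mpr ⟨a, Sym2.eq_swap ▸ h⟩, H, h,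
    Or.inl rfl⟩

lemma CarrierStep.of_square (hX : IsQuasiMedian X) {H : Hyperplane X} {a b c d : V}
    (hab : s(a, b) ∈ H.1) (hcd : s(c, d) ∈ H.1) (hac : X.Adj a c) (hbd : X.Adj b d)
    (had : a ≠ d) (hbc : b ≠ c) : CarrierStep H a c := by
  by_cases hbc' : X.Adj b c
  · exact .of_mem hX (H.mem_of_eqvGen hab
      (eqvGen_of_common_vertex (H.adj hX hab) hac (Or.inr hbc')))
  · refine ⟨hac, mem_hypCarrier_iff.mpr ⟨b, hab⟩, mem_hypCarrier_iff.mpr ⟨d, hcd⟩,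
      edgeHyperplane hac, mem_edgeHyperplane hac, or_iff_not_imp_left.mpr fun hne => ?_⟩
    rw [crossingGraph, SimpleGraph.fromRel_adj]
    exact ⟨hne, Or.inr ⟨a, _, hab, _, mem_edgeHyperplane hac, b, c, rfl, rfl, H.adj hX hab, hac,
      hbc, hbc', d, had.symm, hbd, H.adj hX hcd⟩⟩

lemma carrier_connected_aux (hX : IsQuasiMedian X) {H : Hyperplane X} {e f : Sym2 V}
    (h : Relation.EqvGen (SideRel X) e f) : e ∈ H.1 → f ∈ H.1 → ∀ v ∈ e, ∀ w ∈ f,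
      Relation.ReflTransGen (CarrierStep H) v w := by
  have edge : ∀ a b, s(a, b) ∈ H.1 → ∀ v ∈ s(a, b), ∀ w ∈ s(a, b),
      Relation.ReflTransGen (CarrierStep H) v w := by
    intro a b hab v hv w hw
    rcases Sym2.mem_iff.mp hv with rfl | rfl <;> rcases Sym2.mem_iff.mp hw with rfl | rfl
    · exact .refl
    · exact .single (.of_mem hX hab)
    · exact .single (CarrierStep.of_mem hX hab).symm
    · exact .refl
  induction h with
  | rel e f h =>
    intro he hf v hv w hw
    rcases h with ⟨a, b, c, hab, hac, hbc, rfl, rfl⟩ |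
      ⟨a, b, c, d, hab, hcd, hac, hbd, had, hbc, rfl, rfl⟩
    · exact (edge _ _ he v hv a (Sym2.mem_mk_left _ _)).trans
        (edge _ _ hf a (Sym2.mem_mk_left _ _) w hw)
    · exact ((edge _ _ he v hv a (Sym2.mem_mk_left _ _)).tail
        (.of_square hX he hf hac hbd had hbc)).trans (edge _ _ hf c (Sym2.mem_mk_left _ _) w hw)
  | refl e =>
    intro he _
    induction e using Sym2.ind with
    | _ a b => exact edge a b he
  | symm e f _ ih =>
    intro he hf v hv w hw
    have : Std.Symm (CarrierStep H) := ⟨fun _ _ h => h.symm⟩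
    exact Relation.ReflTransGen.stdSymm.symm _ _ (ih hf he w hw v hv)
  | trans e f k h1 _ ih1 ih2 =>
    intro he hk v hv w hw
    have hf := H.mem_of_eqvGen he h1
    induction f using Sym2.ind with
    | _ a b =>
      exact (ih1 he hf v hv a (Sym2.mem_mk_left _ _)).trans
        (ih2 hf hk a (Sym2.mem_mk_left _ _) w hw)

/-- Any two vertices of a carrier are joined by a path in the carrier whose edges are dual to
the hyperplane or to hyperplanes crossing it. -/
lemma carrier_connected (hX : IsQuasiMedian X) {H : Hyperplane X} {v w : V}
    (hv : v ∈ hypCarrier X H) (hw : w ∈ hypCarrier X H) :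
    Relation.ReflTransGen (CarrierStep H) v w := by
  obtain ⟨e, he, hv⟩ := hv
  obtain ⟨f, hf, hw⟩ := hw
  exact carrier_connected_aux hX (H.eqvGen he hf) he hf v hv w hw

/-- A vertex `p` outside the carrier of `H` is separated from that carrier by a hyperplane `K`
dual to an edge at `p`; the separation is witnessed by a colouring `φ` of the vertices which is
constant along edges not dual to `K`. -/
lemma exists_separating (hX : IsQuasiMedian X) {H : Hyperplane X} {p : V}
    (hp : p ∉ hypCarrier X H) :
    ∃ (K : Hyperplane X) (φ : V → V), p ∈ hypCarrier X K ∧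
      (∀ u v, X.Adj u v → φ u ≠ φ v → s(u, v) ∈ K.1) ∧ ∀ v ∈ hypCarrier X H, φ v ≠ φ p := by
  obtain ⟨C, g, hg, hH⟩ := H.exists_cliqueGate hX
  have hS : ∀ v, v ∈ hypCarrier X H ↔ Splits X g v := by
    intro v
    rw [mem_hypCarrier_iff]
    simp only [hH, Splits]
  have hne : (hypCarrier X H).Nonempty := by
    obtain ⟨_, ⟨x, y⟩, hxy, rfl⟩ := H
    exact ⟨x, s(x, y), Relation.EqvGen.refl _, Sym2.mem_mk_left _ _⟩
  obtain ⟨q, hq, hgate⟩ := hX.exists_gate hne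
    (fun a b c hab hca hcb ha hb => (hS c).mpr
      (hg.splits_of_two_nbrs hX hab hca hcb ((hS a).mp ha) ((hS b).mp hb)))
    (fun v hv w hw => Relation.ReflTransGen.mono
      (fun (a b : V) (h : CarrierStep H a b) => ⟨h.1, h.2.2.1⟩) v w
      (carrier_connected hX hv hw)) p
  have hqp : q ≠ p := by rintro rfl; exact hp hq
  obtain ⟨p', hp₁p, hd⟩ := hX.exists_closer hqp
  obtain ⟨C', φ, hφ, hpC, hp₁C⟩ := hX.exists_cliqueGate hp₁p.symm
  refine ⟨edgeHyperplane hp₁p.symm, φ, mem_hypCarrier_iff.mpr ⟨p', mem_edgeHyperplane _⟩,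
    fun u v huv hne => (hφ.mem_hyperplane_iff hX hpC hp₁C hp₁p.ne' u v).mpr ⟨huv, hne⟩,
    fun v hv => ?_⟩
  rw [hφ.self_eq hX hpC]
  have h1 := hgate v hv
  have h2 := hX.connected.dist_triangle (u := p') (v := q) (w := v)
  rw [X.dist_comm (u := p') (v := q)] at h2
  rw [X.dist_comm (u := p) (v := q)] at h1
  rw [hφ.eq_of_dist_lt hp₁C hpC (by omega : X.dist p' v < X.dist p v)]
  exact hp₁p.ne

/-- Along a sequence of hyperplanes with consecutively meeting carriers, starting at `p`, a
hyperplane separating `p` from a reached vertex equals or crosses a member of the sequence. -/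
lemma exists_crossing_of_chain (hX : IsQuasiMedian X) {K : Hyperplane X} {φ : V → V} {p : V}
    (hφ : ∀ u v, X.Adj u v → φ u ≠ φ v → s(u, v) ∈ K.1) (h : ℕ → Hyperplane X)
    (h0 : p ∈ hypCarrier X (h 0)) (i : ℕ)
    (hh : ∀ j < i, (hypCarrier X (h j) ∩ hypCarrier X (h (j + 1))).Nonempty) :
    ∀ v ∈ hypCarrier X (h i), φ v ≠ φ p →
      ∃ j ≤ i, K = h j ∨ (crossingGraph X).Adj K (h j) := by
  have step : ∀ i v w, v ∈ hypCarrier X (h i) → w ∈ hypCarrier X (h i) → φ w ≠ φ v →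
      K = h i ∨ (crossingGraph X).Adj K (h i) := by
    intro i v w hv hw
    contrapose!
    intro hK
    have := carrier_connected hX hv hw
    clear hw
    induction this with
    | refl => rfl
    | @tail a b _ hab ih =>
      rw [← ih]
      by_contra hne
      obtain ⟨h1, -, -, L, hL, hLH⟩ := hab
      obtain rfl := Hyperplane.eq_of_mem hL (hφ a b h1 (Ne.symm hne))
      exact hLH.elim hK.1 hK.2
  induction i with
  | zero => exact fun v hv hne => ⟨0, le_rfl, step 0 p v h0 hv hne⟩
  | succ i ih =>
    intro v hv hne
    obtain ⟨r, hr, hr'⟩ := hh i (Nat.lt_succ_self i)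
    by_cases hrp : φ r = φ p
    · exact ⟨i + 1, le_rfl, step (i + 1) r v hr' hv (by rwa [hrp])⟩
    · obtain ⟨j, hj, hK⟩ := ih (fun j hj => hh j (by omega)) r hr hrp
      exact ⟨j, by omega, hK⟩

lemma HypIntersect.carrier_inter {H K : Hyperplane X} (h : HypIntersect X H K) :
    (hypCarrier X H ∩ hypCarrier X K).Nonempty := by
  obtain ⟨p, e, he, f, hf, a, b, rfl, rfl, -⟩ := h
  exact ⟨p, ⟨_, he, Sym2.mem_mk_left _ _⟩, ⟨_, hf, Sym2.mem_mk_left _ _⟩⟩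

lemma HypOsculate.carrier_inter {H K : Hyperplane X} (h : HypOsculate X H K) :
    (hypCarrier X H ∩ hypCarrier X K).Nonempty := by
  obtain ⟨p, e, he, f, hf, a, b, rfl, rfl, -⟩ := h
  exact ⟨p, ⟨_, he, Sym2.mem_mk_left _ _⟩, ⟨_, hf, Sym2.mem_mk_left _ _⟩⟩

lemma carrier_inter_of_crossing_adj {H K : Hyperplane X} (h : (crossingGraph X).Adj H K) :
    (hypCarrier X H ∩ hypCarrier X K).Nonempty := by
  rw [crossingGraph, SimpleGraph.fromRel_adj] at h
  rcases h.2 with h | h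
  · exact h.carrier_inter
  · rw [Set.inter_comm]; exact h.carrier_inter

lemma carrier_inter_of_contact_adj {H K : Hyperplane X} (h : (contactGraph X).Adj H K) :
    (hypCarrier X H ∩ hypCarrier X K).Nonempty := by
  rw [contactGraph, SimpleGraph.fromRel_adj] at h
  rcases h.2 with (h | h) | (h | h)
  · exact h.carrier_inter
  · exact h.carrier_inter
  · rw [Set.inter_comm]; exact h.carrier_inter
  · rw [Set.inter_comm]; exact h.carrier_inter

lemma intersect_or_osculate_of_mem_carrier (hX : IsQuasiMedian X) {H K : Hyperplane X} {p : V}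
    (hH : p ∈ hypCarrier X H) (hK : p ∈ hypCarrier X K) (hne : H ≠ K) :
    HypIntersect X H K ∨ HypOsculate X H K := by
  obtain ⟨a, ha⟩ := mem_hypCarrier_iff.mp hH
  obtain ⟨b, hb⟩ := mem_hypCarrier_iff.mp hK
  have hpa := H.adj hX ha
  have hpb := K.adj hX hb
  have hab : ¬ (a = b ∨ X.Adj a b) := fun h => hne
    (Hyperplane.eq_of_mem (H.mem_of_eqvGen ha (eqvGen_of_common_vertex hpa hpb h)) hb)
  rw [not_or] at hab
  by_cases hq : ∃ q : V, q ≠ p ∧ X.Adj a q ∧ X.Adj b q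
  · exact Or.inl ⟨p, _, ha, _, hb, a, b, rfl, rfl, hpa, hpb, hab.1, hab.2, hq⟩
  · exact Or.inr ⟨p, _, ha, _, hb, a, b, rfl, rfl, hpa, hpb, hab.1, hab.2, hq⟩

end Hyperplanes

section QuasiIsometry

/-- If the carriers of the ends of a geodesic in the crossing graph share a vertex `p`, then the
geodesic can be replaced, level by level, by hyperplanes whose carriers contain `p`. -/
lemma exists_hyperplane_at_level (hX : IsQuasiMedian X) (hconn : (crossingGraph X).Connected)
    {p : V} (h : ℕ → Hyperplane X) (m : ℕ) (h0 : p ∈ hypCarrier X (h 0))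
    (hm : p ∈ hypCarrier X (h m)) (hadj : ∀ i < m, (crossingGraph X).Adj (h i) (h (i + 1)))
    (hgeo : ∀ i ≤ m, ∀ j ≤ i, (crossingGraph X).dist (h j) (h i) = i - j) (i : ℕ) (hi : i ≤ m) :
    ∃ K, p ∈ hypCarrier X K ∧ (crossingGraph X).dist (h 0) K = i := by
  by_cases hp : p ∈ hypCarrier X (h i)
  · exact ⟨h i, hp, by rw [hgeo i hi 0 (Nat.zero_le _)]; rfl⟩
  have hi0 : i ≠ 0 := by rintro rfl; exact hp h0
  have him : i ≠ m := by rintro rfl; exact hp hm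
  obtain ⟨K, φ, hpK, hφ, hsep⟩ := exists_separating hX hp
  refine ⟨K, hpK, ?_⟩
  have hinter : ∀ j < m, (hypCarrier X (h j) ∩ hypCarrier X (h (j + 1))).Nonempty :=
    fun j hj => carrier_inter_of_crossing_adj (hadj j hj)
  obtain ⟨j, hj, hKj⟩ : ∃ j ≤ i - 1, K = h j ∨ (crossingGraph X).Adj K (h j) := by
    obtain ⟨r, hr, hr'⟩ := hinter (i - 1) (by omega)
    rw [Nat.sub_add_cancel (by omega)] at hr'
    exact exists_crossing_of_chain hX hφ h h0 (i - 1) (fun j hj => hinter j (by omega)) r hr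
      (hsep r hr')
  obtain ⟨k, hk, hkm, hKk⟩ : ∃ k, i + 1 ≤ k ∧ k ≤ m ∧
      (K = h k ∨ (crossingGraph X).Adj K (h k)) := by
    obtain ⟨r, hr, hr'⟩ := hinter i (by omega)
    obtain ⟨j, hj, hKj⟩ := exists_crossing_of_chain hX hφ (fun t => h (m - t)) hm (m - (i + 1))
      (fun t ht => by
        have := hinter (m - (t + 1)) (by omega)
        rwa [Set.inter_comm, show m - (t + 1) + 1 = m - t by omega] at this)
      r (by
        show r ∈ hypCarrier X (h (m - (m - (i + 1))))
        rwa [show m - (m - (i + 1)) = i + 1 by omega])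
      (hsep r hr)
    exact ⟨m - j, by omega, by omega, hKj⟩
  have hle : ∀ t, K = h t ∨ (crossingGraph X).Adj K (h t) →
      (crossingGraph X).dist K (h t) ≤ 1 := by
    rintro t (rfl | ht)
    · simp
    · rw [SimpleGraph.dist_eq_one_iff_adj.mpr ht]
  have d1 := hle j hKj
  have d2 := hle k hKk
  have d3 := hgeo k hkm j (by omega)
  have t1 := hconn.dist_triangle (u := h j) (v := K) (w := h k)
  have d4 := hgeo j (by omega) 0 (Nat.zero_le _)
  have d5 := hgeo k hkm 0 (Nat.zero_le _)
  have t2 := hconn.dist_triangle (u := h 0) (v := h j) (w := K)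
  have t3 := hconn.dist_triangle (u := h 0) (v := K) (w := h k)
  rw [(crossingGraph X).dist_comm (u := h j) (v := K)] at t1 t2
  omega

variable {G : Type*} [Group G]

lemma sameOrbit_equivalence (α : GraphAction G X) : Equivalence (SameOrbit α) := by
  have hone : α.act 1 = id := funext α.act_one
  have hmul : ∀ a b, α.act (a * b) = α.act a ∘ α.act b := fun a b => funext (α.act_mul a b)
  have himg : ∀ a b S, α.hypImage (a * b) S = α.hypImage a (α.hypImage b S) := by
    intro a b S
    simp only [GraphAction.hypImage, hmul, Set.image_image, Sym2.map_map]
  have himg1 : ∀ S, α.hypImage 1 S = S := by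
    intro S
    simp [GraphAction.hypImage, hone]
  refine ⟨fun H => ⟨1, (himg1 _).symm⟩, ?_, ?_⟩
  · rintro H K ⟨a, ha⟩
    exact ⟨a⁻¹, by rw [ha, ← himg, inv_mul_cancel, himg1]⟩
  · rintro H K L ⟨a, ha⟩ ⟨b, hb⟩
    exact ⟨b * a, by rw [hb, ha, himg]⟩

/-- Hyperplanes with meeting carriers are at bounded distance in the crossing graph. -/
lemma crossing_dist_le_of_carrier_inter (hX : IsQuasiMedian X) (α : GraphAction G X)
    (hsp : IsSpecial α) (hconn : (crossingGraph X).Connected) (hfin : Finite (HypOrbit α))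
    {H K : Hyperplane X} (hHK : (hypCarrier X H ∩ hypCarrier X K).Nonempty) :
    (crossingGraph X).dist H K ≤ Nat.card (HypOrbit α) := by
  obtain ⟨p, hpH, hpK⟩ := hHK
  obtain ⟨w, hw⟩ := hconn.exists_walk_length_eq_dist H K
  set m := (crossingGraph X).dist H K with hm
  have h0 : w.getVert 0 = H := w.getVert_zero
  have hlast : w.getVert m = K := by rw [← hw]; exact w.getVert_length
  have hadj : ∀ i < m, (crossingGraph X).Adj (w.getVert i) (w.getVert (i + 1)) :=
    fun i hi => w.adj_getVert_succ (by omega)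
  have hup : ∀ j t, j + t ≤ m →
      (crossingGraph X).dist (w.getVert j) (w.getVert (j + t)) ≤ t := by
    intro j t
    induction t with
    | zero => simp
    | succ t ih =>
      intro ht
      have h1 := ih (by omega)
      have h2 := hconn.dist_triangle (u := w.getVert j) (v := w.getVert (j + t))
        (w := w.getVert (j + (t + 1)))
      have h3 := SimpleGraph.dist_eq_one_iff_adj.mpr (hadj (j + t) (by omega))
      rw [← Nat.add_assoc] at h2 ⊢
      omega
  have hgeo : ∀ i ≤ m, ∀ j ≤ i,
      (crossingGraph X).dist (w.getVert j) (w.getVert i) = i - j := by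
    intro i hi j hji
    have h1 := hup j (i - j) (by omega)
    have h2 := hup 0 j (by omega)
    have h3 := hup i (m - i) (by omega)
    rw [show j + (i - j) = i by omega] at h1
    rw [h0, show 0 + j = j by omega] at h2
    rw [show i + (m - i) = m by omega, hlast] at h3
    have h4 := hconn.dist_triangle (u := H) (v := w.getVert j) (w := K)
    have h5 := hconn.dist_triangle (u := w.getVert j) (v := w.getVert i) (w := K)
    omega
  have hex := exists_hyperplane_at_level hX hconn w.getVert m (by rwa [h0]) (by rwa [hlast])
    hadj hgeo
  have hex' : ∀ i : Fin (m + 1), ∃ K, p ∈ hypCarrier X K ∧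
      (crossingGraph X).dist (w.getVert 0) K = (i : ℕ) := fun i => hex i (by omega)
  choose L hL hLd using hex'
  let F : Fin (m + 1) → HypOrbit α := fun i => Quot.mk _ (L i)
  have hinj : Function.Injective F := by
    intro i j hij
    have ho : SameOrbit α (L i) (L j) :=
      (sameOrbit_equivalence α).eqvGen_iff.mp (Quot.eqvGen_exact hij)
    by_contra hne
    have hLne : L i ≠ L j := by
      intro h
      have h1 := hLd i
      rw [h, hLd j] at h1
      exact hne (Fin.ext h1.symm)
    exact hsp.1 _ _ ho hLne (intersect_or_osculate_of_mem_carrier hX (hL i) (hL j) hLne)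
  have := Nat.card_le_card_of_injective F hinj
  rw [Nat.card_eq_fintype_card, Fintype.card_fin] at this
  omega

end QuasiIsometry

end QM

namespace QM

/-- **Theorem B(i).** If `G` acts specially on a quasi-median graph `X`, vertices of `ΔX/G`
have uniformly at most `D` neighbours, `ΔX` is connected, and `ΔX/G` has finitely many
vertices, then the inclusion `ΔX ↪ 𝒞X` (the identity on hyperplanes) is a quasi-isometry. -/
theorem crossing_contact_quasiIsometry {V : Type*} {G : Type*} [Group G]
    (X : SimpleGraph V) (hX : IsQuasiMedian X) (α : GraphAction G X) (hsp : IsSpecial α)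
    (D : ℕ) (hD : QuotDegBounded α D)
    (hconn : (crossingGraph X).Connected) (hfin : Finite (HypOrbit α)) :
    ∃ lam c : ℝ, 0 < lam ∧ 0 ≤ c ∧
      IsQuasiIsometry lam c (fun H H' => ((crossingGraph X).dist H H' : ℝ))
        (fun H H' => ((contactGraph X).dist H H' : ℝ)) id := by
  have hle : crossingGraph X ≤ contactGraph X := by
    intro H K h
    rw [crossingGraph, SimpleGraph.fromRel_adj] at h
    rw [contactGraph, SimpleGraph.fromRel_adj]
    exact ⟨h.1, h.2.imp Or.inl Or.inl⟩
  have hcon : (contactGraph X).Connected := hconn.mono hle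
  set N := Nat.card (HypOrbit α) with hN
  have hwalk : ∀ {H K : Hyperplane X} (w : (contactGraph X).Walk H K),
      (crossingGraph X).dist H K ≤ N * w.length := by
    intro H K w
    induction w with
    | nil => simp
    | @cons a b c hab w ih =>
      have h1 := crossing_dist_le_of_carrier_inter hX α hsp hconn hfin
        (carrier_inter_of_contact_adj hab)
      have h2 := hconn.dist_triangle (u := a) (v := b) (w := c)
      rw [SimpleGraph.Walk.length_cons, Nat.mul_succ]
      omega
  refine ⟨N + 1, 0, by positivity, le_rfl, fun H K => ⟨?_, ?_⟩, fun K => ⟨K, ?_⟩⟩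
  · obtain ⟨w, hw⟩ := hcon.exists_walk_length_eq_dist H K
    have h1 := hwalk w
    rw [hw] at h1
    have h2 : ((crossingGraph X).dist H K : ℝ) ≤ N * (contactGraph X).dist H K := by
      exact_mod_cast h1
    rw [sub_zero, div_le_iff₀ (by positivity)]
    have h3 : (0 : ℝ) ≤ (contactGraph X).dist H K := Nat.cast_nonneg _
    simp only [id]
    nlinarith
  · obtain ⟨w, hw⟩ := hconn.exists_walk_length_eq_dist H K
    have h1 := SimpleGraph.dist_le (w.mapLe hle)
    rw [SimpleGraph.Walk.length_map, hw] at h1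
    have h2 : ((contactGraph X).dist H K : ℝ) ≤ (crossingGraph X).dist H K := by
      exact_mod_cast h1
    have h3 : (0 : ℝ) ≤ N * ((crossingGraph X).dist H K : ℝ) := by positivity
    simp only [id]
    nlinarith
  · simp


end QM
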